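/- arXiv:2306.12516 — 5 statements merged into one kernel-verified Lean document; each statement's English description precedes it below -/
import Mathlib

section
/- (Theorem 1.) There exists a separator if and only if L_n → 0 as n → ∞, ν-almost everywhere. -/
open MeasureTheory Filter
open scoped ENNReal

/-- A separator for the pair of measures `(μ, ν)`: a measurable `{0,1}`-valued function that
is `0` `μ`-almost everywhere and `1` `ν`-almost everywhere. -/
def IsSeparator {Ω : Type*} [MeasurableSpace Ω] (μ ν : Measure Ω) (f : Ω → ℝ) : Prop :=
  Measurable f ∧ (∀ ω, f ω = 0 ∨ f ω = 1) ∧ (∀ᵐ ω ∂μ, f ω = 0) ∧ (∀ᵐ ω ∂ν, f ω = 1)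

open scoped Topology

/-- Along a filtration generating the whole `σ`-algebra, the Radon-Nikodym derivatives of the
restrictions of `μ ≪ ν` converge almost everywhere to `dμ/dν` (Lévy's upward theorem). -/
theorem tendsto_ae_rnDeriv_trim_of_absolutelyContinuous
    {Ω : Type*} {m0 : MeasurableSpace Ω} {μ ν : Measure Ω} [IsFiniteMeasure μ] [IsFiniteMeasure ν]
    (ℱ : Filtration ℕ m0) (hsup : (⨆ n, (ℱ n : MeasurableSpace Ω)) = m0) (hμν : μ ≪ ν) :
    ∀ᵐ ω ∂ν, Tendsto (fun n => (μ.trim (ℱ.le n)).rnDeriv (ν.trim (ℱ.le n)) ω) atTop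
      (𝓝 (μ.rnDeriv ν ω)) := by
  have hlevy := Integrable.tendsto_ae_condExp (ℱ := ℱ)
    (Measure.integrable_toReal_rnDeriv (μ := μ) (ν := ν))
    (by rw [hsup]; exact (Measure.measurable_rnDeriv μ ν).ennreal_toReal.stronglyMeasurable)
  have htrim : ∀ᵐ ω ∂ν, ∀ n, (μ.trim (ℱ.le n)).rnDeriv (ν.trim (ℱ.le n)) ω =
      ENNReal.ofReal ((ν[fun ω => (μ.rnDeriv ν ω).toReal | ℱ n]) ω) :=
    ae_all_iff.2 fun n => ae_of_ae_trim (ℱ.le n) (rnDeriv_trim (ℱ.le n) hμν)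
  filter_upwards [hlevy, htrim, μ.rnDeriv_ne_top ν] with ω hlim heq htop
  simp_rw [heq]
  simpa only [ENNReal.ofReal_toReal htop] using ENNReal.tendsto_ofReal hlim

/-- Along a filtration generating the whole `σ`-algebra, the Radon-Nikodym derivatives of the
restrictions of `μ` and `ν` converge `ν`-almost everywhere to the density `dμ/dν` of the
absolutely continuous part of `μ`. -/
theorem tendsto_ae_rnDeriv_trim
    {Ω : Type*} {m0 : MeasurableSpace Ω} (μ ν : Measure Ω) [IsFiniteMeasure μ] [IsFiniteMeasure ν]
    (ℱ : Filtration ℕ m0) (hsup : (⨆ n, (ℱ n : MeasurableSpace Ω)) = m0) :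
    ∀ᵐ ω ∂ν, Tendsto (fun n => (μ.trim (ℱ.le n)).rnDeriv (ν.trim (ℱ.le n)) ω) atTop
      (𝓝 (μ.rnDeriv ν ω)) := by
  have hμ : μ ≪ μ + ν := Measure.AbsolutelyContinuous.rfl.add_right ν
  have hν : ν ≪ μ + ν := by
    rw [add_comm]; exact Measure.AbsolutelyContinuous.rfl.add_right μ
  have hdiv : ∀ᵐ ω ∂ν, ∀ n, (μ.trim (ℱ.le n)).rnDeriv (ν.trim (ℱ.le n)) ω =
      (μ.trim (ℱ.le n)).rnDeriv ((μ + ν).trim (ℱ.le n)) ω /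
        (ν.trim (ℱ.le n)).rnDeriv ((μ + ν).trim (ℱ.le n)) ω :=
    ae_all_iff.2 fun n => ae_of_ae_trim (ℱ.le n)
      (Measure.rnDeriv_eq_div (hμ.trim (ℱ.le n)) (hν.trim (ℱ.le n)))
  filter_upwards [hdiv, Measure.rnDeriv_eq_div hμ hν,
    hν.ae_le (tendsto_ae_rnDeriv_trim_of_absolutelyContinuous ℱ hsup hμ),
    hν.ae_le (tendsto_ae_rnDeriv_trim_of_absolutelyContinuous ℱ hsup hν),
    Measure.rnDeriv_pos hν, hν.ae_le (ν.rnDeriv_ne_top (μ + ν))] with ω hn h hμlim hνlim hpos htop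
  simp_rw [hn, h]
  exact ENNReal.Tendsto.div hμlim (Or.inr hpos.ne') hνlim (Or.inl htop)

/-- A separator for `(μ, ν)` exists exactly when the two measures are mutually singular. -/
theorem exists_isSeparator_iff_mutuallySingular
    {Ω : Type*} [MeasurableSpace Ω] (μ ν : Measure Ω) :
    (∃ f : Ω → ℝ, IsSeparator μ ν f) ↔ μ.MutuallySingular ν := by
  classical
  constructor
  · rintro ⟨f, hf, -, hμ, hν⟩
    refine ⟨f ⁻¹' {1}, hf (measurableSet_singleton 1), ?_, hν⟩
    rw [measure_eq_zero_iff_ae_notMem]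
    filter_upwards [hμ] with ω h
    simp [h]
  · rintro ⟨s, hs, hμ, hν⟩
    refine ⟨s.indicator 1, measurable_one.indicator hs, fun ω => ?_, ?_, ?_⟩
    · by_cases h : ω ∈ s <;> simp [h]
    · filter_upwards [measure_eq_zero_iff_ae_notMem.1 hμ] with ω h
      simp [h]
    · filter_upwards [measure_eq_zero_iff_ae_notMem.1 hν] with ω h
      simp [Set.notMem_compl_iff.1 h]

theorem separator_exists_iff_rnDeriv_tendsto_zero
    {Ω : Type*} [m0 : MeasurableSpace Ω]
    (ℱ : Filtration ℕ m0) (hsup : (⨆ n, (ℱ n : MeasurableSpace Ω)) = m0)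
    (μ ν : Measure Ω) [IsProbabilityMeasure μ] [IsProbabilityMeasure ν]
    (hac : ∀ n : ℕ, μ.trim (ℱ.le n) ≪ ν.trim (ℱ.le n))
    (L : ℕ → Ω → ℝ≥0∞)
    (hL : ∀ n : ℕ, L n = (μ.trim (ℱ.le n)).rnDeriv (ν.trim (ℱ.le n))) :
    (∃ f : Ω → ℝ, IsSeparator μ ν f) ↔
      ∀ᵐ ω ∂ν, Tendsto (fun n => L n ω) atTop (nhds 0) := by
  rw [exists_isSeparator_iff_mutuallySingular, ← Measure.rnDeriv_eq_zero]
  refine eventually_congr ?_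
  filter_upwards [tendsto_ae_rnDeriv_trim μ ν ℱ hsup] with ω hω
  simp_rw [hL]
  exact ⟨fun h => by simpa only [h, Pi.zero_apply] using hω, fun h => tendsto_nhds_unique hω h⟩
end

section
/- (Forward Jessen direction, as used in Theorem 1.) If L_n → 0 ν-almost everywhere as n → ∞, then μ and ν are mutually singular. -/
open MeasureTheory Filter
open scoped ENNReal

theorem MeasureTheory.Measure.rnDeriv_ae_le_of_le {α : Type*} {m : MeasurableSpace α}
    {μ₁ μ₂ ν : Measure α} [IsFiniteMeasure μ₁] [SigmaFinite ν] (hν : μ₂ ≪ ν)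
    [SigmaFinite μ₂] (h : μ₁ ≤ μ₂) :
    μ₁.rnDeriv ν ≤ᵐ[ν] μ₂.rnDeriv ν := by
  refine ae_le_of_forall_setLIntegral_le_of_sigmaFinite (Measure.measurable_rnDeriv _ _)
    fun s hs _ => ?_
  rw [Measure.setLIntegral_rnDeriv hν]
  exact (Measure.setLIntegral_rnDeriv_le s).trans (h s)

theorem mutuallySingular_of_rnDeriv_tendsto_zero
    {Ω : Type*} [m0 : MeasurableSpace Ω]
    (ℱ : Filtration ℕ m0) (hsup : (⨆ n, (ℱ n : MeasurableSpace Ω)) = m0)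
    (μ ν : Measure Ω) [IsProbabilityMeasure μ] [IsProbabilityMeasure ν]
    (hac : ∀ n : ℕ, μ.trim (ℱ.le n) ≪ ν.trim (ℱ.le n))
    (L : ℕ → Ω → ℝ≥0∞)
    (hL : ∀ n : ℕ, L n = (μ.trim (ℱ.le n)).rnDeriv (ν.trim (ℱ.le n)))
    (htendsto : ∀ᵐ ω ∂ν, Tendsto (fun n => L n ω) atTop (nhds 0)) :
    Measure.MutuallySingular μ ν := by
  -- The absolutely continuous part `α` of `μ` has restricted densities dominated by `L n`, and
  -- by Lévy's upward theorem they converge to its density, which therefore vanishes.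
  set α : Measure Ω := ν.withDensity (μ.rnDeriv ν) with hα
  have hαμ : α ≤ μ := Measure.withDensity_rnDeriv_le μ ν
  have : IsFiniteMeasure α := isFiniteMeasure_of_le μ hαμ
  have hαν : α ≪ ν := withDensity_absolutelyContinuous _ _
  have hα_eq : α.rnDeriv ν =ᵐ[ν] μ.rnDeriv ν :=
    Measure.rnDeriv_withDensity ν (Measure.measurable_rnDeriv μ ν)
  have hle : ∀ᵐ ω ∂ν, ∀ n,
      ENNReal.ofReal ((ν[fun x => (α.rnDeriv ν x).toReal | ℱ n]) ω) ≤ L n ω := by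
    refine ae_all_iff.2 fun n => ?_
    have htrim : α.trim (ℱ.le n) ≤ μ.trim (ℱ.le n) := by
      refine Measure.le_iff.2 fun s hs => ?_
      rw [trim_measurableSet_eq _ hs, trim_measurableSet_eq _ hs]
      exact hαμ s
    filter_upwards [ae_of_ae_trim (ℱ.le n) (Measure.rnDeriv_ae_le_of_le (hac n) htrim),
      ae_of_ae_trim (ℱ.le n) (rnDeriv_trim (ℱ.le n) hαν)] with ω h₁ h₂
    rw [← h₂, hL n]
    exact h₁
  have hlim := tendsto_ae_condExp (μ := ν) (ℱ := ℱ) (fun x => (α.rnDeriv ν x).toReal)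
  have hcond : ν[fun x => (α.rnDeriv ν x).toReal | ⨆ n, (ℱ n : MeasurableSpace Ω)]
      = fun x => (α.rnDeriv ν x).toReal := by
    rw [condExp_of_stronglyMeasurable (iSup_le ℱ.le) _ Measure.integrable_toReal_rnDeriv]
    rw [hsup]
    exact (Measure.measurable_rnDeriv α ν).ennreal_toReal.stronglyMeasurable
  rw [hcond] at hlim
  rw [← Measure.rnDeriv_eq_zero]
  filter_upwards [hle, hlim, htendsto, hα_eq, Measure.rnDeriv_ne_top α ν]
    with ω h₁ h₂ h₃ h₄ h₅
  have h₆ := le_of_tendsto_of_tendsto' (ENNReal.tendsto_ofReal h₂) h₃ h₁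
  rw [ENNReal.ofReal_toReal h₅, h₄] at h₆
  exact le_antisymm h₆ bot_le
end

section
/- (Converse Jessen direction, as used in Theorem 1.) If μ and ν are mutually singular, then L_n → 0 ν-almost everywhere as n → ∞. -/
open MeasureTheory Filter
open scoped ENNReal

/-- **Lévy's upward theorem** for densities: if `μ ≪ ρ`, the densities of the restrictions of `μ`
to a filtration generating the whole σ-algebra converge to the density of `μ`. -/
theorem ae_tendsto_rnDeriv_trim {Ω : Type*} [m0 : MeasurableSpace Ω]
    (ℱ : Filtration ℕ m0) (hsup : (⨆ n, (ℱ n : MeasurableSpace Ω)) = m0)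
    (μ ρ : Measure Ω) [IsFiniteMeasure μ] [IsFiniteMeasure ρ] (h : μ ≪ ρ) :
    ∀ᵐ ω ∂ρ, Tendsto (fun n => (μ.trim (ℱ.le n)).rnDeriv (ρ.trim (ℱ.le n)) ω) atTop
      (nhds (μ.rnDeriv ρ ω)) := by
  have hmeas : StronglyMeasurable[⨆ n, ℱ n] (fun ω => (μ.rnDeriv ρ ω).toReal) := by
    rw [hsup]
    exact (Measure.measurable_rnDeriv μ ρ).ennreal_toReal.stronglyMeasurable
  have htrim : ∀ᵐ ω ∂ρ, ∀ n, (μ.trim (ℱ.le n)).rnDeriv (ρ.trim (ℱ.le n)) ω =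
      ENNReal.ofReal ((ρ[fun x => (μ.rnDeriv ρ x).toReal | ℱ n]) ω) :=
    ae_all_iff.2 fun n => ae_eq_of_ae_eq_trim (rnDeriv_trim (ℱ.le n) h)
  filter_upwards [htrim, Measure.integrable_toReal_rnDeriv.tendsto_ae_condExp hmeas,
    Measure.rnDeriv_ne_top μ ρ] with ω h1 h2 h3
  simp_rw [h1]
  simpa [ENNReal.ofReal_toReal h3] using ENNReal.tendsto_ofReal h2

/-- The density of `μ` with respect to a dominating measure vanishes almost everywhere for any
measure singular to `μ` that is also dominated. -/
theorem rnDeriv_ae_eq_zero_of_mutuallySingular {Ω : Type*} [MeasurableSpace Ω]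
    {μ ν ρ : Measure Ω} [IsFiniteMeasure μ] [IsFiniteMeasure ρ]
    (hμ : μ ≪ ρ) (hν : ν ≪ ρ) (hsing : Measure.MutuallySingular μ ν) :
    ∀ᵐ ω ∂ν, μ.rnDeriv ρ ω = 0 := by
  obtain ⟨s, hs, hμs, hνs⟩ := hsing
  have hint : ∫⁻ ω in s, μ.rnDeriv ρ ω ∂ρ = 0 := by
    rw [Measure.setLIntegral_rnDeriv hμ, hμs]
  rw [lintegral_eq_zero_iff (Measure.measurable_rnDeriv μ ρ)] at hint
  have hmem : ∀ᵐ ω ∂ν, ω ∈ s := hνs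
  filter_upwards [hmem, hν.ae_le ((ae_restrict_iff' hs).1 hint)] with ω h1 h2
  exact h2 h1

theorem rnDeriv_tendsto_zero_of_mutuallySingular
    {Ω : Type*} [m0 : MeasurableSpace Ω]
    (ℱ : Filtration ℕ m0) (hsup : (⨆ n, (ℱ n : MeasurableSpace Ω)) = m0)
    (μ ν : Measure Ω) [IsProbabilityMeasure μ] [IsProbabilityMeasure ν]
    (hac : ∀ n : ℕ, μ.trim (ℱ.le n) ≪ ν.trim (ℱ.le n))
    (L : ℕ → Ω → ℝ≥0∞)
    (hL : ∀ n : ℕ, L n = (μ.trim (ℱ.le n)).rnDeriv (ν.trim (ℱ.le n)))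
    (hsing : Measure.MutuallySingular μ ν) :
    ∀ᵐ ω ∂ν, Tendsto (fun n => L n ω) atTop (nhds 0) := by
  have hμ : μ ≪ μ + ν := Measure.AbsolutelyContinuous.rfl.add_right ν
  have hν : ν ≪ μ + ν := by
    rw [add_comm]
    exact Measure.AbsolutelyContinuous.rfl.add_right μ
  have hchain : ∀ᵐ ω ∂(μ + ν), ∀ n,
      L n ω * (ν.trim (ℱ.le n)).rnDeriv ((μ + ν).trim (ℱ.le n)) ω =
        (μ.trim (ℱ.le n)).rnDeriv ((μ + ν).trim (ℱ.le n)) ω := by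
    refine ae_all_iff.2 fun n => ?_
    rw [hL n]
    exact ae_eq_of_ae_eq_trim (Measure.rnDeriv_mul_rnDeriv (hac n))
  have hfin : ∀ᵐ ω ∂(μ + ν), ∀ n,
      (ν.trim (ℱ.le n)).rnDeriv ((μ + ν).trim (ℱ.le n)) ω ≠ ∞ :=
    ae_all_iff.2 fun n => ae_of_ae_trim (ℱ.le n) (Measure.rnDeriv_ne_top _ _)
  filter_upwards [hν.ae_le hchain, hν.ae_le hfin,
    hν.ae_le (ae_tendsto_rnDeriv_trim ℱ hsup μ (μ + ν) hμ),
    hν.ae_le (ae_tendsto_rnDeriv_trim ℱ hsup ν (μ + ν) hν),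
    rnDeriv_ae_eq_zero_of_mutuallySingular hμ hν hsing, Measure.rnDeriv_pos hν]
    with ω hmul hne hX hY hzero hpos
  rw [hzero] at hX
  have hdiv := ENNReal.Tendsto.div hX (Or.inr hpos.ne') hY (Or.inr ENNReal.zero_ne_top)
  rw [ENNReal.zero_div] at hdiv
  refine hdiv.congr' ?_
  filter_upwards [hY.eventually_ne hpos.ne'] with n hn
  rw [← hmul n, ENNReal.mul_div_cancel_right hn (hne n)]
end

section
/- (Essence of the Radon–Nikodym factorization (B.7).) Let μ and ν be σ-finite measures on a measurable space X with μ ≪ ν, and let κ and η be Markov kernels from X to a standard Borel space Y such that κ(x) ≪ η(x) for ν-almost every x. Let g : X × Y → [0, ∞) be a jointly measurable function such that κ(x, B) = ∫_B g(x, y) η(x, dy) for all measurable B ⊆ Y, for ν-almost every x. Then the Radon–Nikodym derivative of μ ⊗ κ with respect to ν ⊗ η satisfies, for (ν ⊗ η)-almost every (x, y): d(μ ⊗ κ)/d(ν ⊗ η)(x, y) = (dμ/dν)(x) · g(x, y). -/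
open MeasureTheory ProbabilityTheory
open scoped ProbabilityTheory ENNReal

lemma sigmaFinite_compProd {X Y : Type*} [MeasurableSpace X] [MeasurableSpace Y]
    (ν : Measure X) [SigmaFinite ν] (η : Kernel X Y) [IsMarkovKernel η] :
    SigmaFinite (ν ⊗ₘ η) := by
  have : SigmaFinite ((ν ⊗ₘ η).map Prod.fst) := by
    rw [← Measure.fst, Measure.fst_compProd]
    infer_instance
  exact SigmaFinite.of_map _ measurable_fst.aemeasurable this

/-- The composition-product of a reweighted measure with a kernel having a density is the
composition-product reweighted by the product of the densities. -/
lemma compProd_eq_withDensity {X Y : Type*} [MeasurableSpace X] [MeasurableSpace Y]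
    (ν : Measure X) [SFinite ν] (κ η : Kernel X Y) [IsSFiniteKernel κ] [IsSFiniteKernel η]
    {f : X → ℝ≥0∞} (hf : Measurable f)
    {g : X × Y → ℝ≥0∞} (hg : Measurable g)
    (hκ : ∀ᵐ x ∂ν, κ x = (η x).withDensity fun y => g (x, y)) :
    (ν.withDensity f) ⊗ₘ κ = (ν ⊗ₘ η).withDensity fun p => f p.1 * g p := by
  have hfg : Measurable fun p : X × Y => f p.1 * g p := (hf.comp measurable_fst).mul hg
  ext s hs
  rw [Measure.compProd_apply hs, withDensity_apply _ hs, ← lintegral_indicator hs,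
    Measure.lintegral_compProd (hfg.indicator hs),
    lintegral_withDensity_eq_lintegral_mul _ hf (Kernel.measurable_kernel_prodMk_left hs)]
  refine lintegral_congr_ae ?_
  filter_upwards [hκ] with x hx
  have hsx : MeasurableSet (Prod.mk x ⁻¹' s) := measurable_prodMk_left hs
  have hgx : Measurable fun y => g (x, y) := hg.comp measurable_prodMk_left
  rw [Pi.mul_apply, hx, withDensity_apply _ hsx, ← lintegral_indicator hsx,
    ← lintegral_const_mul _ (hgx.indicator hsx)]
  refine lintegral_congr fun y => ?_
  by_cases hy : (x, y) ∈ s <;> simp [Set.indicator, hy]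

theorem rnDeriv_compProd_eq_mul
    {X Y : Type*} [MeasurableSpace X] [MeasurableSpace Y] [StandardBorelSpace Y]
    (μ ν : Measure X) [SigmaFinite μ] [SigmaFinite ν]
    (κ η : Kernel X Y) [IsMarkovKernel κ] [IsMarkovKernel η]
    (hμν : μ ≪ ν) (hκη : ∀ᵐ x ∂ν, κ x ≪ η x)
    (g : X → Y → ℝ) (hg : Measurable (Function.uncurry g)) (hg0 : ∀ x y, 0 ≤ g x y)
    (hgdens : ∀ᵐ x ∂ν, ∀ B : Set Y, MeasurableSet B →
      κ x B = ∫⁻ y in B, ENNReal.ofReal (g x y) ∂(η x)) :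
    (μ ⊗ₘ κ).rnDeriv (ν ⊗ₘ η) =ᵐ[ν ⊗ₘ η]
      fun p => μ.rnDeriv ν p.1 * ENNReal.ofReal (g p.1 p.2) := by
  have hgm : Measurable fun p : X × Y => ENNReal.ofReal (g p.1 p.2) := hg.ennreal_ofReal
  have hκ : ∀ᵐ x ∂ν, κ x = (η x).withDensity fun y => ENNReal.ofReal (g x y) := by
    filter_upwards [hgdens] with x hx
    ext B hB
    rw [hx B hB, withDensity_apply _ hB]
  have h := compProd_eq_withDensity ν κ η (Measure.measurable_rnDeriv μ ν) hgm hκ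
  rw [Measure.withDensity_rnDeriv_eq μ ν hμν] at h
  have := sigmaFinite_compProd ν η
  rw [h]
  exact Measure.rnDeriv_withDensity _
    (((Measure.measurable_rnDeriv μ ν).comp measurable_fst).mul hgm)
end

section
/- (Abstract form of Theorem 2(c).) Suppose that, for ν-almost every ω, S_n(ω) := Σ_{t=1}^n λ_max(V̌)^{−1} ‖X_t(ω) − m̌_t(ω)‖² → +∞ as n → ∞, and the ratio r_n(ω) := ( Σ_{t=1}^n λ_min(V)^{−1} ‖X_t(ω) − m_t(ω)‖² ) / S_n(ω) → +∞ as n → ∞. Then μ and ν are mutually singular; equivalently, there exists a measurable map Σ : Ω → {0,1} with Σ = 0 μ-almost everywhere and Σ = 1 ν-almost everywhere. -/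
open MeasureTheory Matrix Filter
open scoped ENNReal

/-- The density of the nondegenerate Gaussian measure `𝒩(m, V)` on `ℝ^N` with respect to
Lebesgue measure. -/
noncomputable def gaussianPdf (N : ℕ) (m : Fin N → ℝ) (V : Matrix (Fin N) (Fin N) ℝ)
    (x : Fin N → ℝ) : ℝ :=
  (2 * Real.pi) ^ (-(N : ℝ) / 2) * V.det ^ (-(1 : ℝ) / 2) *
    Real.exp (-(1 / 2) * ((x - m) ⬝ᵥ V⁻¹ *ᵥ (x - m)))

/-- The nondegenerate multivariate Gaussian measure `𝒩(m, V)` on `ℝ^N`, defined through its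
density with respect to Lebesgue measure. -/
noncomputable def gaussian (N : ℕ) (m : Fin N → ℝ) (V : Matrix (Fin N) (Fin N) ℝ) :
    Measure (Fin N → ℝ) :=
  volume.withDensity fun x => ENNReal.ofReal (gaussianPdf N m V x)

/-- The σ-algebra `𝓖_t = σ(X₀, …, X_t)` generated by the first `t + 1` coordinates of the
sequence space `(ℝ^N)^ℕ`. -/
def seqSigma (N : ℕ) (t : ℕ) : MeasurableSpace (ℕ → (Fin N → ℝ)) :=
  ⨆ i ∈ Set.Iic t, MeasurableSpace.comap (fun ω => ω i) inferInstance

/-- If `κ (T ·)` is the conditional law of `Y` given `T`, tested on rectangles, then it computes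
the joint law of `(T, Y)`. -/
lemma lintegral_comp_prodMk_eq_of_setLIntegral {Ω α β : Type*} {mΩ : MeasurableSpace Ω}
    {mα : MeasurableSpace α} {mβ : MeasurableSpace β} (μ : Measure Ω) [IsFiniteMeasure μ]
    {T : Ω → α} {Y : Ω → β} (hT : Measurable T) (hY : Measurable Y)
    (κ : ProbabilityTheory.Kernel α β) [ProbabilityTheory.IsMarkovKernel κ]
    (h : ∀ A B, MeasurableSet A → MeasurableSet B →
      ∫⁻ ω in T ⁻¹' A, κ (T ω) B ∂μ = μ (T ⁻¹' A ∩ Y ⁻¹' B))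
    {F : α × β → ℝ≥0∞} (hF : Measurable F) :
    ∫⁻ ω, F (T ω, Y ω) ∂μ = ∫⁻ ω, ∫⁻ y, F (T ω, y) ∂(κ (T ω)) ∂μ := by
  have key : (μ.map T).compProd κ = μ.map (fun ω => (T ω, Y ω)) := by
    refine Measure.ext_prod fun {s t} hs ht => ?_
    rw [Measure.compProd_apply_prod hs ht, Measure.map_apply (hT.prodMk hY) (hs.prod ht),
      setLIntegral_map hs (κ.measurable_coe ht) hT, h s t hs ht]
    rfl
  rw [← lintegral_map hF (hT.prodMk hY), ← key, Measure.lintegral_compProd hF,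
    lintegral_map hF.lintegral_kernel_prod_right' hT]

/-- Disintegration of an integral along a kernel which represents the conditional law of `Y`
given a sub-σ-algebra `G`. -/
lemma lintegral_eq_lintegral_lintegral_of_condExp {Ω β : Type*} {G mΩ : MeasurableSpace Ω}
    {mβ : MeasurableSpace β} (hG : G ≤ mΩ) (μ : Measure[mΩ] Ω) [IsFiniteMeasure μ]
    {Y : Ω → β} (hY : Measurable[mΩ] Y)
    (κ : @ProbabilityTheory.Kernel Ω β G mβ) [hκ : @ProbabilityTheory.IsMarkovKernel Ω β G mβ κ]
    (h : ∀ B, MeasurableSet B →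
      μ[fun ω => B.indicator (fun _ => (1 : ℝ)) (Y ω)|G] =ᵐ[μ] fun ω => (κ ω).real B)
    {F : Ω × β → ℝ≥0∞} (hF : Measurable[G.prod mβ] F) :
    ∫⁻ ω, F (ω, Y ω) ∂μ = ∫⁻ ω, ∫⁻ y, F (ω, y) ∂(κ ω) ∂μ := by
  refine @lintegral_comp_prodMk_eq_of_setLIntegral Ω Ω β mΩ G mβ μ _ id Y
    (measurable_id'' hG) hY κ hκ (fun A B hA hB => ?_) F hF
  have hA' : MeasurableSet[mΩ] A := hG A hA
  have hκm : Measurable[mΩ] fun ω => κ ω B :=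
    (ProbabilityTheory.Kernel.measurable_coe κ hB).mono hG le_rfl
  have hint : Integrable (fun ω => B.indicator (fun _ => (1 : ℝ)) (Y ω)) μ :=
    (integrable_const (1 : ℝ)).indicator (hY hB)
  have h1 := setIntegral_condExp hG hint hA
  rw [setIntegral_congr_ae hA' ((h B hB).mono fun ω hω _ => hω)] at h1
  have h2 : ∫ ω in A, B.indicator (fun _ => (1 : ℝ)) (Y ω) ∂μ = μ.real (A ∩ Y ⁻¹' B) := by
    have : (fun ω => B.indicator (fun _ => (1 : ℝ)) (Y ω))
        = (Y ⁻¹' B).indicator (fun _ => (1 : ℝ)) := rfl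
    rw [this, setIntegral_indicator (hY hB)]
    simp
  have h3 : ∫ ω in A, (κ ω).real B ∂μ = (∫⁻ ω in A, κ ω B ∂μ).toReal :=
    integral_toReal hκm.aemeasurable (ae_of_all _ fun ω => measure_lt_top _ _)
  have h4 : ∫⁻ ω in A, κ ω B ∂μ ≠ ∞ := by
    refine ne_top_of_le_ne_top (measure_ne_top μ A) ?_
    calc ∫⁻ ω in A, κ ω B ∂μ ≤ ∫⁻ _ in A, 1 ∂μ := lintegral_mono fun ω => prob_le_one
      _ = μ A := by simp
  rw [h2, h3, measureReal_def] at h1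
  exact (ENNReal.toReal_eq_toReal_iff' h4 (measure_ne_top _ _)).1 h1

/-- A quadratic form is bounded by a multiple of any positive definite one. -/
lemma Matrix.PosDef.exists_dotProduct_mulVec_le {n : Type*} [Fintype n] {A : Matrix n n ℝ}
    (hA : A.PosDef) (B : Matrix n n ℝ) :
    ∃ C : ℝ, 0 < C ∧ ∀ x : n → ℝ, x ⬝ᵥ B *ᵥ x ≤ C * (x ⬝ᵥ A *ᵥ x) := by
  have hpos : ∀ x : n → ℝ, x ≠ 0 → 0 < x ⬝ᵥ A *ᵥ x := fun x hx => by
    simpa using hA.dotProduct_mulVec_pos hx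
  have hc : ∀ D : Matrix n n ℝ, Continuous fun x : n → ℝ => x ⬝ᵥ D *ᵥ x := fun D =>
    continuous_id.dotProduct (continuous_const.matrix_mulVec continuous_id)
  have hcont : ContinuousOn (fun x : n → ℝ => (x ⬝ᵥ B *ᵥ x) / (x ⬝ᵥ A *ᵥ x))
      (Metric.sphere 0 1) :=
    (hc B).continuousOn.div (hc A).continuousOn fun x hx =>
      (hpos x (ne_zero_of_mem_unit_sphere ⟨x, hx⟩)).ne'
  obtain ⟨C, hC⟩ := (isCompact_sphere (0 : n → ℝ) 1).bddAbove_image hcont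
  refine ⟨max C 1, by positivity, fun x => ?_⟩
  by_cases hx : x = 0
  · simp [hx]
  have hn : ‖x‖ ≠ 0 := norm_ne_zero_iff.2 hx
  have hmem : ‖x‖⁻¹ • x ∈ Metric.sphere (0 : n → ℝ) 1 := by
    simp [norm_smul, hn]
  have h := hC (Set.mem_image_of_mem _ hmem)
  simp only [mulVec_smul, smul_dotProduct, dotProduct_smul, smul_eq_mul] at h
  rw [mul_div_mul_left _ _ (inv_ne_zero hn), mul_div_mul_left _ _ (inv_ne_zero hn),
    div_le_iff₀ (hpos x hx)] at h
  exact h.trans (mul_le_mul_of_nonneg_right (le_max_left _ _) (hpos x hx).le)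

lemma Matrix.PosDef.iSup_eigenvalues_pos {n : Type*} [Fintype n] [DecidableEq n] [Nonempty n]
    {A : Matrix n n ℝ} (hA : A.PosDef) : 0 < ⨆ i, hA.1.eigenvalues i := by
  obtain ⟨i, hi⟩ := exists_eq_ciSup_of_finite (f := hA.1.eigenvalues)
  exact hi ▸ hA.eigenvalues_pos i

lemma Matrix.PosDef.iInf_eigenvalues_pos {n : Type*} [Fintype n] [DecidableEq n] [Nonempty n]
    {A : Matrix n n ℝ} (hA : A.PosDef) : 0 < ⨅ i, hA.1.eigenvalues i := by
  obtain ⟨i, hi⟩ := exists_eq_ciInf_of_finite (f := hA.1.eigenvalues)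
  exact hi ▸ hA.eigenvalues_pos i

section Gaussian

variable {N : ℕ}

lemma gaussianPdf_pos (m : Fin N → ℝ) {V : Matrix (Fin N) (Fin N) ℝ} (hV : V.PosDef)
    (x : Fin N → ℝ) : 0 < gaussianPdf N m V x := by
  have := hV.det_pos
  unfold gaussianPdf
  positivity

lemma continuous_gaussianPdf (V : Matrix (Fin N) (Fin N) ℝ) :
    Continuous fun p : (Fin N → ℝ) × (Fin N → ℝ) => gaussianPdf N p.1 V p.2 := by
  unfold gaussianPdf
  have h : Continuous fun p : (Fin N → ℝ) × (Fin N → ℝ) => p.2 - p.1 := by fun_prop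
  exact continuous_const.mul (Real.continuous_exp.comp
    (continuous_const.mul (h.dotProduct (continuous_const.matrix_mulVec h))))

lemma measurable_gaussianPdf (m : Fin N → ℝ) (V : Matrix (Fin N) (Fin N) ℝ) :
    Measurable (gaussianPdf N m V) :=
  ((continuous_gaussianPdf V).comp (Continuous.prodMk_right m)).measurable

lemma gaussian_univ_eq (m m' : Fin N → ℝ) (V : Matrix (Fin N) (Fin N) ℝ) :
    gaussian N m V Set.univ = gaussian N m' V Set.univ := by
  have h : ∀ m : Fin N → ℝ, gaussian N m V Set.univ
      = ∫⁻ x, ENNReal.ofReal (gaussianPdf N 0 V x) := fun m => by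
    rw [gaussian, withDensity_apply _ MeasurableSet.univ, Measure.restrict_univ,
      ← lintegral_sub_right_eq_self (μ := volume)
        (fun x => ENNReal.ofReal (gaussianPdf N 0 V x)) m]
    simp [gaussianPdf]
  rw [h, h]

/-- The Gaussian measure with covariance `V` is normalised as soon as it is a conditional law. -/
lemma gaussian_univ_eq_one_of_condExp {Ω : Type*} {G mΩ : MeasurableSpace Ω} (hG : G ≤ mΩ)
    (μ : Measure[mΩ] Ω) [IsProbabilityMeasure μ] {V : Matrix (Fin N) (Fin N) ℝ}
    {M : Ω → Fin N → ℝ}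
    (h : μ[fun _ => (1 : ℝ)|G] =ᵐ[μ] fun ω => ∫ _, (1 : ℝ) ∂(gaussian N (M ω) V))
    (m : Fin N → ℝ) : gaussian N m V Set.univ = 1 := by
  rw [condExp_const hG] at h
  obtain ⟨ω, hω⟩ := h.exists
  rw [gaussian_univ_eq m (M ω) V]
  simp only [integral_const, smul_eq_mul, mul_one, measureReal_def] at hω
  exact (ENNReal.toReal_eq_one_iff _).1 hω.symm

/-- The Gaussian measures with covariance `V`, as a kernel in the mean. -/
noncomputable def gaussianKernel (V : Matrix (Fin N) (Fin N) ℝ) :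
    ProbabilityTheory.Kernel (Fin N → ℝ) (Fin N → ℝ) where
  toFun m := gaussian N m V
  measurable' := by
    refine Measure.measurable_of_measurable_coe _ fun s hs => ?_
    simp only [gaussian, withDensity_apply _ hs]
    exact (ENNReal.measurable_ofReal.comp
      (continuous_gaussianPdf V).measurable).lintegral_prod_right'

/-- The density ratio of `𝒩(m', V')` with respect to `𝒩(m, V)`. -/
noncomputable def gaussianRatio (N : ℕ) (V V' : Matrix (Fin N) (Fin N) ℝ)
    (m m' x : Fin N → ℝ) : ℝ≥0∞ :=
  ENNReal.ofReal (gaussianPdf N m' V' x / gaussianPdf N m V x)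

lemma measurable_gaussianRatio {Ω : Type*} {mΩ : MeasurableSpace Ω}
    (V V' : Matrix (Fin N) (Fin N) ℝ) {m m' X : Ω → Fin N → ℝ}
    (hm : Measurable m) (hm' : Measurable m') (hX : Measurable X) :
    Measurable fun ω => gaussianRatio N V V' (m ω) (m' ω) (X ω) :=
  (((continuous_gaussianPdf V').measurable.comp (hm'.prodMk hX)).div
    ((continuous_gaussianPdf V).measurable.comp (hm.prodMk hX))).ennreal_ofReal

lemma lintegral_gaussianRatio {V : Matrix (Fin N) (Fin N) ℝ} (hV : V.PosDef)
    (V' : Matrix (Fin N) (Fin N) ℝ) (m m' : Fin N → ℝ) :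
    ∫⁻ x, gaussianRatio N V V' m m' x ∂(gaussian N m V) = gaussian N m' V' Set.univ := by
  rw [gaussian, lintegral_withDensity_eq_lintegral_mul _
      (measurable_gaussianPdf m V).ennreal_ofReal
      (measurable_gaussianRatio V V' measurable_const measurable_const measurable_id'),
    gaussian, withDensity_apply _ MeasurableSet.univ, Measure.restrict_univ]
  refine lintegral_congr fun x => ?_
  have h := gaussianPdf_pos m hV x
  rw [Pi.mul_apply, gaussianRatio, ← ENNReal.ofReal_mul h.le, mul_div_cancel₀ _ h.ne']

lemma ofReal_exp_le_gaussianRatio {V V' : Matrix (Fin N) (Fin N) ℝ} (hV : V.PosDef)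
    (hV' : V'.PosDef) (hdet : V'.det ≤ V.det) (m m' x : Fin N → ℝ) :
    ENNReal.ofReal (Real.exp (1 / 2 * ((x - m) ⬝ᵥ V⁻¹ *ᵥ (x - m))
      - 1 / 2 * ((x - m') ⬝ᵥ V'⁻¹ *ᵥ (x - m')))) ≤ gaussianRatio N V V' m m' x := by
  refine ENNReal.ofReal_le_ofReal ?_
  rw [le_div_iff₀ (gaussianPdf_pos m hV x)]
  have hd : V.det ^ (-(1 : ℝ) / 2) ≤ V'.det ^ (-(1 : ℝ) / 2) :=
    Real.rpow_le_rpow_of_nonpos hV'.det_pos hdet (by norm_num)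
  unfold gaussianPdf
  generalize (x - m) ⬝ᵥ V⁻¹ *ᵥ (x - m) = a
  generalize (x - m') ⬝ᵥ V'⁻¹ *ᵥ (x - m') = b
  calc Real.exp (1 / 2 * a - 1 / 2 * b) * ((2 * Real.pi) ^ (-(N : ℝ) / 2)
        * V.det ^ (-(1 : ℝ) / 2) * Real.exp (-(1 / 2) * a))
      = (2 * Real.pi) ^ (-(N : ℝ) / 2) * V.det ^ (-(1 : ℝ) / 2)
        * (Real.exp (1 / 2 * a - 1 / 2 * b) * Real.exp (-(1 / 2) * a)) := by ring
    _ = (2 * Real.pi) ^ (-(N : ℝ) / 2) * V.det ^ (-(1 : ℝ) / 2)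
        * Real.exp (-(1 / 2) * b) := by rw [← Real.exp_add]; congr 2; ring
    _ ≤ _ := by gcongr

end Gaussian

lemma seqSigma_mono (N : ℕ) : Monotone (seqSigma N) := fun _ _ h =>
  biSup_mono fun _ hi => le_trans hi h

lemma seqSigma_le (N t : ℕ) : seqSigma N t ≤ MeasurableSpace.pi :=
  iSup₂_le fun i _ => (measurable_pi_apply i).comap_le

lemma measurable_eval_seqSigma (N t : ℕ) :
    Measurable[seqSigma N t] fun ω : ℕ → (Fin N → ℝ) => ω t :=
  Measurable.of_comap_le (le_iSup₂_of_le t (Set.mem_Iic.2 le_rfl) le_rfl)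

/-- The likelihood ratio process of the conditional laws `𝒩(m' t, V')` with respect to
`𝒩(m t, V)`. -/
noncomputable def likelihoodRatio (N : ℕ) (V V' : Matrix (Fin N) (Fin N) ℝ)
    (m m' : ℕ → (ℕ → (Fin N → ℝ)) → (Fin N → ℝ)) (n : ℕ) (ω : ℕ → (Fin N → ℝ)) : ℝ≥0∞ :=
  ∏ t ∈ Finset.range n, gaussianRatio N V V' (m (t + 1) ω) (m' (t + 1) ω) (ω (t + 1))

section LikelihoodRatio

variable {N : ℕ} {V V' : Matrix (Fin N) (Fin N) ℝ}
  {m m' : ℕ → (ℕ → (Fin N → ℝ)) → (Fin N → ℝ)}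

lemma measurable_likelihoodRatio (hm : ∀ t : ℕ, Measurable[seqSigma N t] (m (t + 1)))
    (hm' : ∀ t : ℕ, Measurable[seqSigma N t] (m' (t + 1))) (n : ℕ) :
    Measurable[seqSigma N n] (likelihoodRatio N V V' m m' n) := by
  refine Finset.measurable_fun_prod _ fun t ht => ?_
  have htn : t + 1 ≤ n := Finset.mem_range.1 ht
  exact measurable_gaussianRatio V V'
    ((hm t).mono (seqSigma_mono N (by omega)) le_rfl)
    ((hm' t).mono (seqSigma_mono N (by omega)) le_rfl)
    ((measurable_eval_seqSigma N (t + 1)).mono (seqSigma_mono N htn) le_rfl)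

/-- The likelihood ratio has expectation one. -/
lemma lintegral_likelihoodRatio (μ : Measure (ℕ → (Fin N → ℝ))) [IsProbabilityMeasure μ]
    (hV : V.PosDef) (hV1 : ∀ a, gaussian N a V Set.univ = 1)
    (hV_one' : ∀ a, gaussian N a V' Set.univ = 1)
    (hm : ∀ t : ℕ, Measurable[seqSigma N t] (m (t + 1)))
    (hm' : ∀ t : ℕ, Measurable[seqSigma N t] (m' (t + 1)))
    (hcond : ∀ t : ℕ, ∀ B : Set (Fin N → ℝ), MeasurableSet B →
      μ[fun ω => B.indicator (fun _ => (1 : ℝ)) (ω (t + 1))|seqSigma N t] =ᵐ[μ]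
        fun ω => (gaussian N (m (t + 1) ω) V).real B) (n : ℕ) :
    ∫⁻ ω, likelihoodRatio N V V' m m' n ω ∂μ = 1 := by
  induction n with
  | zero => simp [likelihoodRatio]
  | succ n ih =>
    let κ : @ProbabilityTheory.Kernel (ℕ → (Fin N → ℝ)) (Fin N → ℝ) (seqSigma N n) _ :=
      @ProbabilityTheory.Kernel.comap _ _ _ _ _ (seqSigma N n) (gaussianKernel V) (m (n + 1)) (hm n)
    have hκ : @ProbabilityTheory.IsMarkovKernel _ _ (seqSigma N n) _ κ :=
      @ProbabilityTheory.IsMarkovKernel.mk _ _ (seqSigma N n) _ κ fun ω => ⟨hV1 _⟩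
    let F : (ℕ → (Fin N → ℝ)) × (Fin N → ℝ) → ℝ≥0∞ := fun p =>
      likelihoodRatio N V V' m m' n p.1 *
        gaussianRatio N V V' (m (n + 1) p.1) (m' (n + 1) p.1) p.2
    have hF : Measurable[(seqSigma N n).prod inferInstance] F := by
      have hfst := @measurable_fst _ (Fin N → ℝ) (seqSigma N n) inferInstance
      have hsnd := @measurable_snd _ (Fin N → ℝ) (seqSigma N n) inferInstance
      exact ((measurable_likelihoodRatio hm hm' n).comp hfst).mul
        (measurable_gaussianRatio V V' ((hm n).comp hfst) ((hm' n).comp hfst) hsnd)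
    have hstep := lintegral_eq_lintegral_lintegral_of_condExp (seqSigma_le N n) μ
      (Y := fun ω => ω (n + 1)) (measurable_pi_apply _) κ (hcond n) hF
    have hleft : ∀ ω, F (ω, ω (n + 1)) = likelihoodRatio N V V' m m' (n + 1) ω := fun ω =>
      (Finset.prod_range_succ _ n).symm
    have hright : ∀ ω, ∫⁻ y, F (ω, y) ∂(κ ω) = likelihoodRatio N V V' m m' n ω := fun ω => by
      change ∫⁻ y, likelihoodRatio N V V' m m' n ω *
        gaussianRatio N V V' (m (n + 1) ω) (m' (n + 1) ω) y ∂(gaussian N (m (n + 1) ω) V) = _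
      rw [lintegral_const_mul _
        (measurable_gaussianRatio V V' measurable_const measurable_const measurable_id'),
        lintegral_gaussianRatio hV, hV_one', mul_one]
    simp only [hleft, hright] at hstep
    rw [hstep, ih]

/-- The likelihood ratio explodes along sequences whose energy ratio explodes. -/
lemma tendsto_likelihoodRatio_top (hV : V.PosDef) (hV' : V'.PosDef) (hdet : V'.det ≤ V.det)
    {c c' : ℝ} (hc : 0 < c) (hc' : 0 < c') {ω : ℕ → (Fin N → ℝ)}
    (hS : Tendsto (fun n => ∑ t ∈ Finset.range n,
      c' * ((ω (t + 1) - m' (t + 1) ω) ⬝ᵥ (ω (t + 1) - m' (t + 1) ω))) atTop atTop)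
    (hr : Tendsto (fun n => (∑ t ∈ Finset.range n,
        c * ((ω (t + 1) - m (t + 1) ω) ⬝ᵥ (ω (t + 1) - m (t + 1) ω))) /
      (∑ t ∈ Finset.range n,
        c' * ((ω (t + 1) - m' (t + 1) ω) ⬝ᵥ (ω (t + 1) - m' (t + 1) ω)))) atTop atTop) :
    Tendsto (fun n => likelihoodRatio N V V' m m' n ω) atTop (nhds ∞) := by
  obtain ⟨a, ha, hA⟩ := hV.inv.exists_dotProduct_mulVec_le 1
  obtain ⟨b, hb, hB⟩ := (PosDef.one (n := Fin N) (R := ℝ)).exists_dotProduct_mulVec_le V'⁻¹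
  simp only [one_mulVec] at hA hB
  set S : ℕ → ℝ := fun n => ∑ t ∈ Finset.range n,
    c' * ((ω (t + 1) - m' (t + 1) ω) ⬝ᵥ (ω (t + 1) - m' (t + 1) ω)) with hSdef
  set R : ℕ → ℝ := fun n => ∑ t ∈ Finset.range n,
    c * ((ω (t + 1) - m (t + 1) ω) ⬝ᵥ (ω (t + 1) - m (t + 1) ω)) with hRdef
  have hlow : ∀ n, ENNReal.ofReal (Real.exp (1 / (2 * a * c) * R n - b / (2 * c') * S n))
      ≤ likelihoodRatio N V V' m m' n ω := fun n => by
    rw [hSdef, hRdef]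
    simp only [Finset.mul_sum]
    rw [← Finset.sum_sub_distrib, Real.exp_sum,
      ENNReal.ofReal_prod_of_nonneg fun _ _ => (Real.exp_pos _).le]
    refine Finset.prod_le_prod' fun t _ => le_trans (ENNReal.ofReal_le_ofReal
      (Real.exp_le_exp.2 ?_)) (ofReal_exp_le_gaussianRatio hV hV' hdet _ _ _)
    have h1 := hA (ω (t + 1) - m (t + 1) ω)
    have h2 := hB (ω (t + 1) - m' (t + 1) ω)
    generalize (ω (t + 1) - m (t + 1) ω) ⬝ᵥ (ω (t + 1) - m (t + 1) ω) = x at *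
    generalize (ω (t + 1) - m' (t + 1) ω) ⬝ᵥ (ω (t + 1) - m' (t + 1) ω) = y at *
    have e1 : 1 / (2 * a * c) * (c * x) = 1 / 2 * (x / a) := by field_simp
    have e2 : b / (2 * c') * (c' * y) = 1 / 2 * (b * y) := by field_simp
    rw [e1, e2]
    have h3 := (div_le_iff₀' ha).2 h1
    linarith
  refine tendsto_nhds_top_mono (ENNReal.tendsto_ofReal_atTop.comp
    (Real.tendsto_exp_atTop.comp hS)) ?_
  filter_upwards [hS.eventually_ge_atTop 1,
    hr.eventually_ge_atTop ((1 + b / (2 * c')) * (2 * a * c))] with n hn1 hn2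
  refine le_trans (ENNReal.ofReal_le_ofReal (Real.exp_le_exp.2 ?_)) (hlow n)
  change (1 + b / (2 * c')) * (2 * a * c) ≤ R n / S n at hn2
  rw [le_div_iff₀ (by linarith)] at hn2
  have h4 : (1 + b / (2 * c')) * S n ≤ 1 / (2 * a * c) * R n := by
    rw [one_div, inv_mul_eq_div, le_div_iff₀ (by positivity)]
    linarith
  linarith

end LikelihoodRatio

/-- Nonnegative random variables with bounded `μ`-expectation that explode `ν`-almost everywhere
witness mutual singularity. -/
lemma MeasureTheory.Measure.MutuallySingular.of_tendsto_top {Ω : Type*} {mΩ : MeasurableSpace Ω}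
    {μ ν : Measure Ω} {L : ℕ → Ω → ℝ≥0∞} (hL : ∀ n, Measurable (L n))
    {C : ℝ≥0∞} (hC : C ≠ ∞) (hμ : ∀ n, ∫⁻ ω, L n ω ∂μ ≤ C)
    (hν : ∀ᵐ ω ∂ν, Tendsto (fun n => L n ω) atTop (nhds ∞)) : Measure.MutuallySingular μ ν := by
  have hmeas : Measurable fun ω => liminf (fun n => L n ω) atTop := .liminf hL
  have hfin : ∫⁻ ω, liminf (fun n => L n ω) atTop ∂μ ≠ ∞ :=
    ne_top_of_le_ne_top hC ((lintegral_liminf_le hL).trans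
      ((liminf_le_liminf (.of_forall hμ)).trans (by simp)))
  refine ⟨{ω | liminf (fun n => L n ω) atTop = ∞}, hmeas (measurableSet_singleton _), ?_, ?_⟩
  · have h := ae_lt_top hmeas hfin
    simpa [ae_iff, lt_top_iff_ne_top] using h
  · have h : ∀ᵐ ω ∂ν, liminf (fun n => L n ω) atTop = ∞ := hν.mono fun ω hω => hω.liminf_eq
    exact ae_iff.1 h

lemma MeasureTheory.Measure.MutuallySingular.exists_isSeparator {Ω : Type*}
    [MeasurableSpace Ω] {μ ν : Measure Ω} (h : Measure.MutuallySingular μ ν) :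
    ∃ f : Ω → ℝ, IsSeparator μ ν f := by
  obtain ⟨s, hs, hμ, hν⟩ := h
  refine ⟨s.indicator fun _ => 1, measurable_const.indicator hs, fun ω => ?_, ?_, ?_⟩
  · by_cases hω : ω ∈ s <;> simp [hω]
  · filter_upwards [measure_eq_zero_iff_ae_notMem.1 hμ] with ω hω
    simp [hω]
  · filter_upwards [measure_eq_zero_iff_ae_notMem.1 hν] with ω hω
    simp [Set.notMem_compl_iff.1 hω]

theorem mutuallySingular_of_energy_ratio_tendsto_atTop
    {N : ℕ} (hN : 0 < N)
    (μ ν : Measure (ℕ → (Fin N → ℝ)))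
    [IsProbabilityMeasure μ] [IsProbabilityMeasure ν]
    (h0 : μ.map (fun ω => ω 0) = ν.map (fun ω => ω 0))
    (V Vc : Matrix (Fin N) (Fin N) ℝ) (hV : V.PosDef) (hVc : Vc.PosDef)
    (hdet : Vc.det ≤ V.det)
    (m mc : ℕ → (ℕ → (Fin N → ℝ)) → (Fin N → ℝ))
    (hm : ∀ t : ℕ, Measurable[seqSigma N t] (m (t + 1)))
    (hmc : ∀ t : ℕ, Measurable[seqSigma N t] (mc (t + 1)))
    (hcondμ : ∀ t : ℕ, ∀ f : (Fin N → ℝ) → ℝ, Measurable f → (∃ C : ℝ, ∀ x, |f x| ≤ C) →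
      μ[(fun ω => f (ω (t + 1)))|seqSigma N t] =ᵐ[μ]
        fun ω => ∫ y, f y ∂(gaussian N (m (t + 1) ω) V))
    (hcondν : ∀ t : ℕ, ∀ f : (Fin N → ℝ) → ℝ, Measurable f → (∃ C : ℝ, ∀ x, |f x| ≤ C) →
      ν[(fun ω => f (ω (t + 1)))|seqSigma N t] =ᵐ[ν]
        fun ω => ∫ y, f y ∂(gaussian N (mc (t + 1) ω) Vc))
    (hS : ∀ᵐ ω ∂ν,
      Tendsto (fun n => ∑ t ∈ Finset.range n,
          (⨆ i, hVc.1.eigenvalues i)⁻¹ *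
            ((ω (t + 1) - mc (t + 1) ω) ⬝ᵥ (ω (t + 1) - mc (t + 1) ω)))
        atTop atTop)
    (hr : ∀ᵐ ω ∂ν,
      Tendsto (fun n =>
          (∑ t ∈ Finset.range n,
            (⨅ i, hV.1.eigenvalues i)⁻¹ *
              ((ω (t + 1) - m (t + 1) ω) ⬝ᵥ (ω (t + 1) - m (t + 1) ω))) /
          (∑ t ∈ Finset.range n,
            (⨆ i, hVc.1.eigenvalues i)⁻¹ *
              ((ω (t + 1) - mc (t + 1) ω) ⬝ᵥ (ω (t + 1) - mc (t + 1) ω))))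
        atTop atTop) :
    Measure.MutuallySingular μ ν ∧ ∃ f : (ℕ → (Fin N → ℝ)) → ℝ, IsSeparator μ ν f := by
  have : Nonempty (Fin N) := ⟨⟨0, hN⟩⟩
  have hV1 : ∀ a, gaussian N a V Set.univ = 1 := gaussian_univ_eq_one_of_condExp
    (seqSigma_le N 0) μ (hcondμ 0 (fun _ => 1) measurable_const ⟨1, by simp⟩)
  have hVc1 : ∀ a, gaussian N a Vc Set.univ = 1 := gaussian_univ_eq_one_of_condExp
    (seqSigma_le N 0) ν (hcondν 0 (fun _ => 1) measurable_const ⟨1, by simp⟩)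
  have hcond : ∀ t : ℕ, ∀ B : Set (Fin N → ℝ), MeasurableSet B →
      μ[fun ω => B.indicator (fun _ => (1 : ℝ)) (ω (t + 1))|seqSigma N t] =ᵐ[μ]
        fun ω => (gaussian N (m (t + 1) ω) V).real B := fun t B hB => by
    have hbound : ∀ x, |B.indicator (fun _ => (1 : ℝ)) x| ≤ 1 := fun x => by
      by_cases hx : x ∈ B <;> simp [hx]
    refine (hcondμ t _ (measurable_const.indicator hB) ⟨1, hbound⟩).trans (.of_eq ?_)
    funext ω
    simp [integral_indicator hB]
  have hsing : Measure.MutuallySingular μ ν := by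
    refine .of_tendsto_top (L := likelihoodRatio N V Vc m mc)
      (fun n => (measurable_likelihoodRatio hm hmc n).mono (seqSigma_le N n) le_rfl)
      ENNReal.one_ne_top
      (fun n => (lintegral_likelihoodRatio μ hV hV1 hVc1 hm hmc hcond n).le) ?_
    filter_upwards [hS, hr] with ω hSω hrω
    exact tendsto_likelihoodRatio_top hV hVc hdet (inv_pos.2 hV.iInf_eigenvalues_pos)
      (inv_pos.2 hVc.iSup_eigenvalues_pos) hSω hrω
  exact ⟨hsing, hsing.exists_isSeparator⟩
end
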